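/- Let n ≥ 2, let θ₁,…,θ_{2n} be the 2n dihedral permutations of ℤ/2n given by θ_{2k−1}(v) = v − 2(k−1) and θ_{2k}(v) = 2 − v + 2(k−1) (1 ≤ k ≤ n), with permutation matrices P_{θ_j} ∈ M_{2n}(ℤ), and let r⁰ = (r⁰₁,…,r⁰_{2n}) be a tuple of nonnegative integers with alternating sum h₀ = r⁰₁ − r⁰₂ + ⋯ − r⁰_{2n}. Then the set of alternating sums r₁ − r₂ + ⋯ − r_{2n}, as r = (r₁,…,r_{2n}) ranges over all tuples of nonnegative integers with Σ_j r_j P_{θ_j} = Σ_j r⁰_j P_{θ_j}, is exactly { h₀ + 2nk : k ∈ ℤ, −min{r⁰_j : j odd} ≤ k ≤ min{r⁰_j : j even} }. In other words, the homology range of a rigid embedding is an interval in the congruence class h₀ + 2nℤ. -/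

import Mathlib

/-- The `2n` dihedral permutations of `ℤ/2n`, indexed by `j : Fin (2n)` whose 1-based label
is `j.val + 1`: in 1-based labels, `θ_{2k−1}(v) = v − 2(k−1)` and `θ_{2k}(v) = 2 − v + 2(k−1)`
for `1 ≤ k ≤ n`. -/
def dihedralPerm (n : ℕ) (j : Fin (2 * n)) : ZMod (2 * n) → ZMod (2 * n) :=
  if Even j.val then fun v => v - (j.val : ZMod (2 * n))
  else fun v => ((j.val : ZMod (2 * n)) + 1) - v

/-- The permutation matrix `P_θ ∈ M_{2n}(ℤ)` of `θ : ℤ/2n → ℤ/2n`: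
`(P_θ)_{iv} = 1` if `θ(v) = i` and `0` otherwise. -/
def permMat (n : ℕ) (θ : ZMod (2 * n) → ZMod (2 * n)) :
    Matrix (ZMod (2 * n)) (ZMod (2 * n)) ℤ :=
  fun i v => if θ v = i then 1 else 0

/-- The alternating sum `r₁ − r₂ + r₃ − ⋯ − r_{2n}` (1-based labels, so the 1-based odd
terms are the `j : Fin (2n)` with `j.val` even). -/
def altSum (n : ℕ) (r : Fin (2 * n) → ℤ) : ℤ :=
  ∑ j : Fin (2 * n), if Even j.val then r j else -(r j)

theorem natCast_zmod_eq_iff_fin_eq {m : ℕ} (j a : Fin m) :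
    (j.val : ZMod m) = (a.val : ZMod m) ↔ j = a := by
  rw [ZMod.natCast_eq_natCast_iff', Nat.mod_eq_of_lt j.2, Nat.mod_eq_of_lt a.2, Fin.ext_iff]

/-- The `(i, v)` entry of `Σ_j r_j P_{θ_j}` involves only the indices `v - i` and `i + v - 1`. -/
theorem sum_smul_permMat_apply (n : ℕ) (r : Fin (2 * n) → ℤ) (i v : ZMod (2 * n))
    (a b : Fin (2 * n)) (ha : (a.val : ZMod (2 * n)) = v - i)
    (hb : (b.val : ZMod (2 * n)) = i + v - 1) :
    (∑ j : Fin (2 * n), r j • permMat n (dihedralPerm n j)) i v =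
      (if Even a.val then r a else 0) + (if Even b.val then 0 else r b) := by
  have key : ∀ j : Fin (2 * n), (r j • permMat n (dihedralPerm n j)) i v =
      (if j = a then (if Even j.val then r j else 0) else 0) +
        (if j = b then (if Even j.val then 0 else r j) else 0) := by
    intro j
    by_cases hj : Even j.val
    · have h : v - (j.val : ZMod (2 * n)) = i ↔ j = a := by
        rw [← natCast_zmod_eq_iff_fin_eq, ha]
        constructor <;> intro h <;> linear_combination -h
      simp [permMat, dihedralPerm, hj, h]
    · have h : (j.val : ZMod (2 * n)) + 1 - v = i ↔ j = b := by
        rw [← natCast_zmod_eq_iff_fin_eq, hb]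
        constructor <;> intro h <;> linear_combination h
      simp [permMat, dihedralPerm, hj, h]
  rw [Matrix.sum_apply, Finset.sum_congr rfl fun j _ => key j, Finset.sum_add_distrib]
  simp

theorem even_iff_not_even_of_cast_eq {n a b : ℕ} {v i : ZMod (2 * n)} (hn : 0 < n)
    (ha : (a : ZMod (2 * n)) = v - i) (hb : (b : ZMod (2 * n)) = i + v - 1) :
    Even a ↔ ¬ Even b := by
  have : NeZero (2 * n) := ⟨by omega⟩
  have h : ((a + b + 1 : ℕ) : ZMod (2 * n)) = ((2 * v.val : ℕ) : ZMod (2 * n)) := by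
    push_cast
    rw [ha, hb, ZMod.natCast_zmod_val]
    ring
  rw [ZMod.natCast_eq_natCast_iff] at h
  have h2 : a + b + 1 ≡ 2 * v.val [MOD 2] := h.of_mul_right n
  simp only [Nat.ModEq] at h2
  simp only [Nat.even_iff]
  omega

/-- Two coefficient tuples have the same matrix exactly when they agree on all sums of an
even-indexed and an odd-indexed coefficient. -/
theorem sum_smul_permMat_eq_iff {n : ℕ} (hn : 0 < n) (r s : Fin (2 * n) → ℤ) :
    (∑ j : Fin (2 * n), r j • permMat n (dihedralPerm n j)) =
        (∑ j : Fin (2 * n), s j • permMat n (dihedralPerm n j)) ↔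
      ∀ a b : Fin (2 * n), Even a.val → ¬ Even b.val → r a + r b = s a + s b := by
  have : NeZero (2 * n) := ⟨by omega⟩
  constructor
  · intro h a b ha hb
    obtain ⟨c, hc⟩ : Even (a.val + b.val + 1) := by
      simp only [Nat.even_iff] at *
      omega
    have hc' : (a.val : ZMod (2 * n)) + b.val + 1 = c + c := by exact_mod_cast congrArg _ hc
    have e := congrFun (congrFun h ((c : ZMod (2 * n)) - a.val)) c
    have h1 : (a.val : ZMod (2 * n)) = c - (c - a.val) := by ring
    have h2 : (b.val : ZMod (2 * n)) = c - a.val + c - 1 := by linear_combination hc'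
    rw [sum_smul_permMat_apply n r _ _ a b h1 h2, sum_smul_permMat_apply n s _ _ a b h1 h2] at e
    simpa [ha, hb] using e
  · intro h
    ext i v
    have h1 : (((v - i).val : ℕ) : ZMod (2 * n)) = v - i := ZMod.natCast_zmod_val _
    have h2 : (((i + v - 1).val : ℕ) : ZMod (2 * n)) = i + v - 1 := ZMod.natCast_zmod_val _
    have par := even_iff_not_even_of_cast_eq hn h1 h2
    rw [sum_smul_permMat_apply n r i v ⟨_, ZMod.val_lt _⟩ ⟨_, ZMod.val_lt _⟩ h1 h2,
      sum_smul_permMat_apply n s i v ⟨_, ZMod.val_lt _⟩ ⟨_, ZMod.val_lt _⟩ h1 h2]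
    by_cases hb : Even (i + v - 1).val
    · have ha : ¬ Even (v - i).val := fun ha => par.1 ha hb
      simp [ha, hb]
    · have ha := par.2 hb
      simpa [ha, hb] using h ⟨_, ZMod.val_lt (v - i)⟩ ⟨_, ZMod.val_lt (i + v - 1)⟩ ha hb

theorem altSum_eq_add_of_shift {n : ℕ} {r s : Fin (2 * n) → ℤ} {k : ℤ}
    (he : ∀ j : Fin (2 * n), Even j.val → r j = s j + k)
    (ho : ∀ j : Fin (2 * n), ¬ Even j.val → r j = s j - k) :
    altSum n r = altSum n s + 2 * n * k := by
  have key : ∀ j : Fin (2 * n), (if Even j.val then r j else -(r j)) =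
      (if Even j.val then s j else -(s j)) + k := by
    intro j
    split_ifs with hj
    · exact he j hj
    · rw [ho j hj]
      ring
  simp [altSum, key, Finset.sum_add_distrib]

/-- Let `n ≥ 2` and let `r⁰` be a tuple of nonnegative integers with
alternating sum `h₀`.  The set of alternating sums of tuples of nonnegative integers with
the same `K₀` matrix `Σ_j r_j P_{θ_j}` as `r⁰` is exactly the interval
`{h₀ + 2nk : −min{r⁰_j : j odd} ≤ k ≤ min{r⁰_j : j even}}` in the congruence class
`h₀ + 2nℤ`. -/
theorem homology_range (n : ℕ) (hn : 2 ≤ n) (r₀ : Fin (2 * n) → ℕ) :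
    {h : ℤ | ∃ r : Fin (2 * n) → ℕ,
        (∑ j : Fin (2 * n), (r j : ℤ) • permMat n (dihedralPerm n j)) =
          (∑ j : Fin (2 * n), (r₀ j : ℤ) • permMat n (dihedralPerm n j)) ∧
        altSum n (fun j => (r j : ℤ)) = h} =
      {h : ℤ | ∃ k : ℤ,
        h = altSum n (fun j => (r₀ j : ℤ)) + 2 * n * k ∧
        (∀ j : Fin (2 * n), Even j.val → -(r₀ j : ℤ) ≤ k) ∧
        (∀ j : Fin (2 * n), ¬ Even j.val → k ≤ (r₀ j : ℤ))} := by
  have hpos : 0 < n := by omega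
  ext h
  simp only [Set.mem_ofPred_eq, sum_smul_permMat_eq_iff hpos]
  constructor
  · rintro ⟨r, hr, rfl⟩
    let z : Fin (2 * n) := ⟨0, by omega⟩
    let u : Fin (2 * n) := ⟨1, by omega⟩
    have hz : Even z.val := Even.zero
    have hu : ¬ Even u.val := Nat.not_even_one
    have he : ∀ j : Fin (2 * n), Even j.val → (r j : ℤ) = r₀ j + (r z - r₀ z) := by
      intro j hj
      linarith [hr j u hj hu, hr z u hz hu]
    have ho : ∀ j : Fin (2 * n), ¬ Even j.val → (r j : ℤ) = r₀ j - (r z - r₀ z) := by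
      intro j hj
      linarith [hr z j hz hj]
    refine ⟨r z - r₀ z, altSum_eq_add_of_shift he ho, fun j hj => ?_, fun j hj => ?_⟩
    · linarith [he j hj, Int.natCast_nonneg (r j)]
    · linarith [ho j hj, Int.natCast_nonneg (r j)]
  · rintro ⟨k, rfl, hke, hko⟩
    let r : Fin (2 * n) → ℕ := fun j =>
      if Even j.val then (r₀ j + k : ℤ).toNat else (r₀ j - k : ℤ).toNat
    have he : ∀ j : Fin (2 * n), Even j.val → (r j : ℤ) = r₀ j + k := by
      intro j hj
      simp only [r, if_pos hj]
      exact Int.toNat_of_nonneg (by linarith [hke j hj])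
    have ho : ∀ j : Fin (2 * n), ¬ Even j.val → (r j : ℤ) = r₀ j - k := by
      intro j hj
      simp only [r, if_neg hj]
      exact Int.toNat_of_nonneg (by linarith [hko j hj])
    refine ⟨r, fun a b ha hb => ?_, altSum_eq_add_of_shift he ho⟩
    rw [he a ha, ho b hb]
    ring
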